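/- For every natural number p ≥ 1 there exists a constant C > 0, depending only on p, such that for every bivariate polynomial q of total degree ≤ p the following holds on the unit square K = (0,1)². Let N be the set of boundary nodes consisting, on each of the four edges of K, of the p + 1 equispaced points including the two endpoints (so N contains the 4 vertices and p − 1 interior nodes per edge, 4p points in total). For every multi-index α = (α₁, α₂) with |α| = α₁ + α₂ ≤ p − 2 let m_α(x,y) = (x − 1/2)^{α₁} (y − 1/2)^{α₂}. Then ∫_K |∇q|² dx dy ≤ C ( Σ_{ξ ∈ N} q(ξ)² + Σ_{|α| ≤ p−2} ( ∫_K m_α q dx dy )² ). -/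

import Mathlib

open MeasureTheory

/-- Evaluation of a bivariate polynomial at a point of `ℝ × ℝ`. -/
noncomputable def evP (q : MvPolynomial (Fin 2) ℝ) (z : ℝ × ℝ) : ℝ :=
  MvPolynomial.eval ![z.1, z.2] q

/-- Squared Euclidean norm of the gradient of a bivariate polynomial. -/
noncomputable def gradSqP (q : MvPolynomial (Fin 2) ℝ) (z : ℝ × ℝ) : ℝ :=
  (evP (MvPolynomial.pderiv (0 : Fin 2) q) z) ^ 2 +
    (evP (MvPolynomial.pderiv (1 : Fin 2) q) z) ^ 2

/-- The set of boundary nodes of the unit square: on each edge, the `p + 1`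
equispaced points including the endpoints (`4p` points in total, since the
`Finset` union identifies the shared vertices). -/
noncomputable def bdryNodes (p : ℕ) : Finset (ℝ × ℝ) :=
  (Finset.range (p + 1)).image (fun j : ℕ => ((j : ℝ) / (p : ℝ), (0 : ℝ))) ∪
  (Finset.range (p + 1)).image (fun j : ℕ => ((1 : ℝ), (j : ℝ) / (p : ℝ))) ∪
  (Finset.range (p + 1)).image (fun j : ℕ => ((j : ℝ) / (p : ℝ), (1 : ℝ))) ∪
  (Finset.range (p + 1)).image (fun j : ℕ => ((0 : ℝ), (j : ℝ) / (p : ℝ)))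

/-- The multi-indices `α = (α₁, α₂)` with `|α| = α₁ + α₂ ≤ p − 2`
(empty when `p = 1`, since then `p − 2 = −1 < 0`). -/
def momIdx (p : ℕ) : Finset (ℕ × ℕ) :=
  (Finset.range (p + 1) ×ˢ Finset.range (p + 1)).filter
    (fun ab => (ab.1 : ℤ) + (ab.2 : ℤ) ≤ (p : ℤ) - 2)

/-- The scaled monomial `m_α` centered at the centroid `(1/2, 1/2)` of the
unit square. -/
noncomputable def monC (ab : ℕ × ℕ) (z : ℝ × ℝ) : ℝ :=
  (z.1 - 1 / 2) ^ ab.1 * (z.2 - 1 / 2) ^ ab.2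

open MvPolynomial in
theorem evP_continuous (q : MvPolynomial (Fin 2) ℝ) : Continuous (evP q) := by
  unfold evP
  refine (MvPolynomial.continuous_eval q).comp ?_
  refine continuous_pi fun i => ?_
  fin_cases i
  · exact continuous_fst
  · exact continuous_snd

theorem gradSqP_continuous (q : MvPolynomial (Fin 2) ℝ) : Continuous (gradSqP q) := by
  unfold gradSqP
  exact ((evP_continuous _).pow 2).add ((evP_continuous _).pow 2)

theorem monC_continuous (ab : ℕ × ℕ) : Continuous (monC ab) := by
  unfold monC
  fun_prop

theorem integrableOn_sq {f : ℝ × ℝ → ℝ} (hf : Continuous f) :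
    IntegrableOn f (Set.Ioo (0 : ℝ) 1 ×ˢ Set.Ioo (0 : ℝ) 1) := by
  have hc : IsCompact (Set.Icc (0 : ℝ) 1 ×ˢ Set.Icc (0 : ℝ) 1) := isCompact_Icc.prod isCompact_Icc
  exact (hf.continuousOn.integrableOn_compact hc).mono_set
    (Set.prod_mono Set.Ioo_subset_Icc_self Set.Ioo_subset_Icc_self)

open MvPolynomial in
/-- Substitution of the constant `a` for the variable `i`. -/
noncomputable def sbst (i : Fin 2) (a : ℝ) :
    MvPolynomial (Fin 2) ℝ →ₐ[ℝ] MvPolynomial (Fin 2) ℝ :=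
  MvPolynomial.aeval (Function.update (X : Fin 2 → MvPolynomial (Fin 2) ℝ) i (C a))

open MvPolynomial in
theorem dvd_of_sbst (i : Fin 2) (a : ℝ) (q : MvPolynomial (Fin 2) ℝ) (h : sbst i a q = 0) :
    (X i - C a) ∣ q := by
  rw [← Ideal.mem_span_singleton, ← Ideal.Quotient.eq_zero_iff_mem]
  set I := Ideal.span {(X i - C a : MvPolynomial (Fin 2) ℝ)}
  have key : (Ideal.Quotient.mkₐ ℝ I).comp (sbst i a) = Ideal.Quotient.mkₐ ℝ I := by
    ext j
    simp only [AlgHom.comp_apply, sbst, aeval_X]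
    by_cases hj : j = i
    · subst hj
      simp only [Function.update_self]
      symm
      exact (Ideal.Quotient.eq).2 (Ideal.subset_span rfl)
    · rw [Function.update_of_ne hj]
  have := DFunLike.congr_fun key q
  rw [AlgHom.comp_apply, h, map_zero] at this
  exact this.symm

open MvPolynomial in
theorem eval_sbst (i : Fin 2) (a : ℝ) (q : MvPolynomial (Fin 2) ℝ) (x : Fin 2 → ℝ) :
    eval x (sbst i a q) = eval (Function.update x i a) q := by
  have : (MvPolynomial.aeval x).comp (sbst i a) =
      (MvPolynomial.aeval (Function.update x i a) : MvPolynomial (Fin 2) ℝ →ₐ[ℝ] ℝ) := by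
    ext j
    simp only [AlgHom.comp_apply, sbst, aeval_X]
    by_cases hj : j = i
    · subst hj; simp
    · simp [Function.update_of_ne hj]
  have := DFunLike.congr_fun this q
  simpa [AlgHom.comp_apply, MvPolynomial.coe_aeval_eq_eval] using this

open MvPolynomial in
theorem sbst_eq_zero (p : ℕ) (hp : 1 ≤ p) (i : Fin 2) (a : ℝ) (q : MvPolynomial (Fin 2) ℝ)
    (hq : q.totalDegree ≤ p)
    (h : ∀ j ≤ p, eval (Function.update (fun _ => (j : ℝ) / p) i a) q = 0) :
    sbst i a q = 0 := by
  set f : Polynomial ℝ := MvPolynomial.aeval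
    (Function.update (fun _ : Fin 2 => (Polynomial.X : Polynomial ℝ)) i (Polynomial.C a)) q with hf
  have hev : ∀ t : ℝ, f.eval t = eval (Function.update (fun _ => t) i a) q := by
    intro t
    have : (Polynomial.aeval t).comp (MvPolynomial.aeval
      (Function.update (fun _ : Fin 2 => (Polynomial.X : Polynomial ℝ)) i (Polynomial.C a))) =
      (MvPolynomial.aeval (Function.update (fun _ => t) i a) : MvPolynomial (Fin 2) ℝ →ₐ[ℝ] ℝ) := by
      ext j
      simp only [AlgHom.comp_apply, aeval_X]
      by_cases hj : j = i
      · subst hj; simp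
      · simp [Function.update_of_ne hj]
    have := DFunLike.congr_fun this q
    simpa [AlgHom.comp_apply, MvPolynomial.coe_aeval_eq_eval, Polynomial.coe_aeval_eq_eval]
      using this
  have hdeg : f.natDegree ≤ p * 1 := by
    refine MvPolynomial.aeval_natDegree_le q hq _ (fun j => ?_)
    by_cases hj : j = i
    · subst hj; simp
    · simp [Function.update_of_ne hj]
  have hp0 : (p : ℝ) ≠ 0 := by positivity
  have hf0 : f = 0 := by
    apply Polynomial.eq_zero_of_natDegree_lt_card_of_eval_eq_zero f
      (f := fun j : Fin (p + 1) => ((j : ℕ) : ℝ) / p)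
    · intro j k hjk
      simp only at hjk
      rw [div_left_inj' hp0] at hjk
      exact Fin.ext (by exact_mod_cast hjk)
    · intro j
      rw [hev]
      exact h j (by omega)
    · simp; omega
  apply MvPolynomial.funext
  intro x
  rw [eval_sbst, map_zero]
  have h2 : Function.update x i a = Function.update (fun _ => x (1 - i)) i a := by
    ext j
    fin_cases i <;> fin_cases j <;> simp [Function.update]
  rw [h2, ← hev, hf0, Polynomial.eval_zero]

open MvPolynomial in
theorem totalDegree_aeval_le (g : Fin 2 → MvPolynomial (Fin 2) ℝ) (hg : ∀ i, (g i).totalDegree ≤ 1)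
    (q : MvPolynomial (Fin 2) ℝ) : (MvPolynomial.aeval g q).totalDegree ≤ q.totalDegree := by
  rw [MvPolynomial.aeval_def, MvPolynomial.eval₂_eq]
  apply totalDegree_finsetSum_le
  intro d hd
  refine (totalDegree_mul _ _).trans ?_
  have h1 : (algebraMap ℝ (MvPolynomial (Fin 2) ℝ) (coeff d q)).totalDegree = 0 := totalDegree_C _
  rw [h1, zero_add]
  refine (totalDegree_finsetProd _ _).trans ?_
  refine le_trans ?_ (le_totalDegree hd)
  rw [Finsupp.sum]
  apply Finset.sum_le_sum
  intro j _
  refine (totalDegree_pow _ _).trans ?_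
  nlinarith [hg j]

open MvPolynomial in
theorem tdeg_lin (i : Fin 2) (a : ℝ) :
    (X i - C a : MvPolynomial (Fin 2) ℝ).totalDegree = 1 := by
  rw [sub_eq_add_neg, ← C_neg, totalDegree_add_eq_left_of_totalDegree_lt]
  · simp
  · simp

open MvPolynomial in
/-- Expansion in centered monomials. -/
theorem expand_monC (r : MvPolynomial (Fin 2) ℝ) :
    ∃ r' : MvPolynomial (Fin 2) ℝ, r'.totalDegree ≤ r.totalDegree ∧
      ∀ z, evP r z = ∑ d ∈ r'.support, coeff d r' * monC (d 0, d 1) z := by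
  refine ⟨MvPolynomial.aeval (fun i => X i + C (1 / 2)) r, ?_, ?_⟩
  · apply totalDegree_aeval_le
    intro i
    refine (totalDegree_add _ _).trans ?_
    simp
  · intro z
    set r' := MvPolynomial.aeval (fun i => (X i + C (1 / 2) : MvPolynomial (Fin 2) ℝ)) r with hr'
    have h1 : evP r z = eval ![z.1 - 1 / 2, z.2 - 1 / 2] r' := by
      have : (MvPolynomial.aeval ![z.1 - 1 / 2, z.2 - 1 / 2]).comp
          (MvPolynomial.aeval (fun i => (X i + C (1 / 2) : MvPolynomial (Fin 2) ℝ))) =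
          (MvPolynomial.aeval ![z.1, z.2] : MvPolynomial (Fin 2) ℝ →ₐ[ℝ] ℝ) := by
        ext j
        fin_cases j <;> simp [AlgHom.comp_apply]
      have := DFunLike.congr_fun this r
      simp only [AlgHom.comp_apply, MvPolynomial.coe_aeval_eq_eval] at this
      exact this.symm
    rw [h1, MvPolynomial.eval_eq']
    apply Finset.sum_congr rfl
    intro d _
    simp [monC, Fin.prod_univ_two]

open MvPolynomial in
theorem factor_bdry (q : MvPolynomial (Fin 2) ℝ)
    (h00 : sbst 0 0 q = 0) (h01 : sbst 0 1 q = 0) (h10 : sbst 1 0 q = 0) (h11 : sbst 1 1 q = 0) :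
    ∃ r, q = (X 0 - C 0) * ((X 0 - C 1) * ((X 1 - C 0) * ((X 1 - C 1) * r))) := by
  have hne : ∀ (i : Fin 2) (a : ℝ), (X i - C a : MvPolynomial (Fin 2) ℝ) ≠ 0 := by
    intro i a h
    have := tdeg_lin i a
    rw [h] at this
    simp at this
  have hs1 : ∀ (i j : Fin 2) (a b : ℝ), i ≠ j → sbst i a (X j - C b) = X j - C b := by
    intro i j a b hij
    simp [sbst, Function.update_of_ne hij.symm, MvPolynomial.algebraMap_eq]
  have hs2 : ∀ (i : Fin 2) (a b : ℝ), a ≠ b → sbst i a (X i - C b) ≠ 0 := by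
    intro i a b hab
    simp only [sbst, map_sub, aeval_X, Function.update_self, aeval_C, MvPolynomial.algebraMap_eq]
    rw [← C_sub, Ne, C_eq_zero]
    exact sub_ne_zero.2 hab
  obtain ⟨r1, rfl⟩ := dvd_of_sbst 0 0 q h00
  rw [map_mul] at h01 h10 h11
  have g01 := (mul_eq_zero.1 h01).resolve_left (hs2 0 1 0 one_ne_zero)
  obtain ⟨r2, rfl⟩ := dvd_of_sbst 0 1 r1 g01
  rw [hs1 _ _ _ _ (by decide), map_mul, hs1 _ _ _ _ (by decide)] at h10 h11
  have g10 := (mul_eq_zero.1 ((mul_eq_zero.1 h10).resolve_left (hne _ _))).resolve_left (hne _ _)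
  have g11 := (mul_eq_zero.1 ((mul_eq_zero.1 h11).resolve_left (hne _ _))).resolve_left (hne _ _)
  obtain ⟨r3, rfl⟩ := dvd_of_sbst 1 0 r2 g10
  rw [map_mul] at g11
  have g11' := (mul_eq_zero.1 g11).resolve_left (hs2 1 1 0 one_ne_zero)
  obtain ⟨r4, rfl⟩ := dvd_of_sbst 1 1 r3 g11'
  exact ⟨r4, rfl⟩

open MvPolynomial in
/-- Unisolvence of the degrees of freedom. -/
theorem unisolvent (p : ℕ) (hp : 1 ≤ p) (q : MvPolynomial (Fin 2) ℝ) (hq : q.totalDegree ≤ p)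
    (hN : ∀ ξ ∈ bdryNodes p, evP q ξ = 0)
    (hM : ∀ ab ∈ momIdx p,
      (∫ z in Set.Ioo (0 : ℝ) 1 ×ˢ Set.Ioo (0 : ℝ) 1, monC ab z * evP q z) = 0) : q = 0 := by
  have hu0 : ∀ a t : ℝ, Function.update (fun _ : Fin 2 => t) 0 a = ![a, t] := by
    intro a t; ext j; fin_cases j <;> simp [Function.update]
  have hu1 : ∀ a t : ℝ, Function.update (fun _ : Fin 2 => t) 1 a = ![t, a] := by
    intro a t; ext j; fin_cases j <;> simp [Function.update]
  have h00 : sbst 0 0 q = 0 := by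
    refine sbst_eq_zero p hp 0 0 q hq fun j hj => ?_
    rw [hu0]
    refine hN (0, (j : ℝ) / p) ?_
    simp only [bdryNodes, Finset.mem_union, Finset.mem_image, Finset.mem_range]
    exact Or.inr ⟨j, by omega, rfl⟩
  have h01 : sbst 0 1 q = 0 := by
    refine sbst_eq_zero p hp 0 1 q hq fun j hj => ?_
    rw [hu0]
    refine hN (1, (j : ℝ) / p) ?_
    simp only [bdryNodes, Finset.mem_union, Finset.mem_image, Finset.mem_range]
    exact Or.inl (Or.inl (Or.inr ⟨j, by omega, rfl⟩))
  have h10 : sbst 1 0 q = 0 := by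
    refine sbst_eq_zero p hp 1 0 q hq fun j hj => ?_
    rw [hu1]
    refine hN ((j : ℝ) / p, 0) ?_
    simp only [bdryNodes, Finset.mem_union, Finset.mem_image, Finset.mem_range]
    exact Or.inl (Or.inl (Or.inl ⟨j, by omega, rfl⟩))
  have h11 : sbst 1 1 q = 0 := by
    refine sbst_eq_zero p hp 1 1 q hq fun j hj => ?_
    rw [hu1]
    refine hN ((j : ℝ) / p, 1) ?_
    simp only [bdryNodes, Finset.mem_union, Finset.mem_image, Finset.mem_range]
    exact Or.inl (Or.inr ⟨j, by omega, rfl⟩)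
  obtain ⟨r, hr⟩ := factor_bdry q h00 h01 h10 h11
  have hne : ∀ (i : Fin 2) (a : ℝ), (X i - C a : MvPolynomial (Fin 2) ℝ) ≠ 0 := by
    intro i a h
    have := tdeg_lin i a
    rw [h] at this
    simp at this
  by_contra hq0
  have hr0 : r ≠ 0 := by
    rintro rfl
    exact hq0 (by simpa using hr)
  have hdeg : q.totalDegree = r.totalDegree + 4 := by
    rw [hr, totalDegree_mul_of_isDomain, totalDegree_mul_of_isDomain, totalDegree_mul_of_isDomain,
      totalDegree_mul_of_isDomain, tdeg_lin, tdeg_lin, tdeg_lin, tdeg_lin]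
    · ring
    all_goals first
      | exact hne _ _
      | exact hr0
      | (simp only [ne_eq, mul_eq_zero, hne, hr0, or_self, not_false_eq_true])
  obtain ⟨r', hr'd, hr'⟩ := expand_monC r
  have hint : (∫ z in Set.Ioo (0 : ℝ) 1 ×ˢ Set.Ioo (0 : ℝ) 1, evP r z * evP q z) = 0 := by
    simp_rw [hr', Finset.sum_mul]
    rw [integral_finsetSum]
    · apply Finset.sum_eq_zero
      intro d hd
      simp_rw [mul_assoc]
      rw [integral_const_mul, hM, mul_zero]
      have h3 := le_totalDegree hd
      rw [Finsupp.sum_fintype _ _ (by simp), Fin.sum_univ_two] at h3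
      simp only [momIdx, Finset.mem_filter, Finset.mem_product, Finset.mem_range]
      omega
    · intro d _
      apply integrableOn_sq
      exact (continuous_const.mul (monC_continuous _)).mul (evP_continuous _)
  have hqz : ∀ z, evP q z = (z.1 * (z.1 - 1) * (z.2 * (z.2 - 1))) * evP r z := by
    intro z
    rw [hr]
    simp [evP]
    ring
  have hwpos : ∀ z ∈ Set.Ioo (0 : ℝ) 1 ×ˢ Set.Ioo (0 : ℝ) 1,
      0 < z.1 * (z.1 - 1) * (z.2 * (z.2 - 1)) := by
    rintro ⟨x, y⟩ ⟨⟨hx0, hx1⟩, ⟨hy0, hy1⟩⟩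
    exact mul_pos_of_neg_of_neg (mul_neg_of_pos_of_neg hx0 (by simpa using hx1))
      (mul_neg_of_pos_of_neg hy0 (by simpa using hy1))
  have hcont : Continuous fun z => evP r z * evP q z := (evP_continuous _).mul (evP_continuous _)
  have hopen : IsOpen (Set.Ioo (0 : ℝ) 1 ×ˢ Set.Ioo (0 : ℝ) 1) := isOpen_Ioo.prod isOpen_Ioo
  have hnn : ∀ z ∈ Set.Ioo (0 : ℝ) 1 ×ˢ Set.Ioo (0 : ℝ) 1, 0 ≤ evP r z * evP q z := by
    intro z hz
    rw [hqz]
    nlinarith [mul_nonneg (hwpos z hz).le (sq_nonneg (evP r z))]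
  have hae : (fun z => evP r z * evP q z) =ᵐ[volume.restrict
      (Set.Ioo (0 : ℝ) 1 ×ˢ Set.Ioo (0 : ℝ) 1)] fun _ => 0 := by
    refine (setIntegral_eq_zero_iff_of_nonneg_ae ?_ (integrableOn_sq hcont)).1 hint
    exact (ae_restrict_iff' hopen.measurableSet).2 (Filter.Eventually.of_forall hnn)
  have heq := Measure.eqOn_open_of_ae_eq hae hopen hcont.continuousOn continuousOn_const
  apply hr0
  refine MvPolynomial.funext_set (fun _ => Set.Ioo (0 : ℝ) 1)
    (fun _ => Set.Ioo_infinite zero_lt_one) ?_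
  intro x hx
  have hz : (x 0, x 1) ∈ Set.Ioo (0 : ℝ) 1 ×ˢ Set.Ioo (0 : ℝ) 1 :=
    ⟨hx 0 trivial, hx 1 trivial⟩
  have h5 := heq hz
  simp only [hqz] at h5
  have h6 := hwpos _ hz
  have h7 : evP r (x 0, x 1) = 0 := by
    rcases mul_eq_zero.1 h5 with h | h
    · exact h
    · exact (mul_eq_zero.1 h).resolve_left h6.ne'
  have h8 : x = ![x 0, x 1] := by ext j; fin_cases j <;> rfl
  rw [map_zero, h8]
  exact h7

theorem exists_repr {V ι : Type*} [AddCommGroup V] [Module ℝ V] [Fintype ι]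
    (L : V →ₗ[ℝ] (ι → ℝ)) (hL : LinearMap.ker L = ⊥) :
    ∃ e : ι → V, ∀ v, v = ∑ i, L v i • e i := by
  classical
  obtain ⟨g, hg⟩ := L.exists_leftInverse_of_injective hL
  refine ⟨fun i => g (Pi.single i 1), fun v => ?_⟩
  have h1 : g (L v) = v := DFunLike.congr_fun hg v
  conv_lhs => rw [← h1, pi_eq_sum_univ' (L v)]
  rw [map_sum]
  refine Finset.sum_congr rfl fun i _ => ?_
  rw [map_smul]

theorem evP_sum {ι : Type*} [Fintype ι] (c : ι → ℝ) (e : ι → MvPolynomial (Fin 2) ℝ) (z : ℝ × ℝ) :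
    evP (∑ i, c i • e i) z = ∑ i, c i * evP (e i) z := by
  simp [evP, MvPolynomial.smul_eval]

theorem gradSqP_sum_le {ι : Type*} [Fintype ι] (c : ι → ℝ) (e : ι → MvPolynomial (Fin 2) ℝ)
    (z : ℝ × ℝ) :
    gradSqP (∑ i, c i • e i) z ≤ (∑ i, c i ^ 2) * ∑ i, gradSqP (e i) z := by
  simp only [gradSqP, map_sum, Derivation.map_smul, evP_sum, Finset.sum_add_distrib, mul_add]
  exact add_le_add (Finset.sum_mul_sq_le_sq_mul_sq _ _ _) (Finset.sum_mul_sq_le_sq_mul_sq _ _ _)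

/-- All degrees of freedom, as a linear map. -/
noncomputable def dofMap (p : ℕ) : MvPolynomial.restrictTotalDegree (Fin 2) ℝ p →ₗ[ℝ]
    ((bdryNodes p) ⊕ (momIdx p) → ℝ) where
  toFun q := Sum.elim (fun ξ => evP q.1 ξ.1)
    (fun ab => ∫ z in Set.Ioo (0 : ℝ) 1 ×ˢ Set.Ioo (0 : ℝ) 1, monC ab.1 z * evP q.1 z)
  map_add' q r := by
    have h : ∀ z, evP (q.1 + r.1) z = evP q.1 z + evP r.1 z := fun z => by simp [evP]
    ext (i | i)
    · simp [h]
    · simp only [Submodule.coe_add, Sum.elim_inr, Pi.add_apply, h, mul_add]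
      exact integral_add (integrableOn_sq ((monC_continuous _).mul (evP_continuous _)))
        (integrableOn_sq ((monC_continuous _).mul (evP_continuous _)))
  map_smul' c q := by
    have h : ∀ z, evP (c • q.1) z = c * evP q.1 z := fun z => by
      simp [evP, MvPolynomial.smul_eval]
    ext (i | i)
    · simp [h]
    · simp only [Submodule.coe_smul, Sum.elim_inr, Pi.smul_apply, h, RingHom.id_apply, smul_eq_mul]
      rw [← integral_const_mul]
      congr 1
      ext z
      ring

/-- lower stability bound for the "dofi-dofi" stabilization of the
nodal conforming virtual element space on the unit square, for polynomials of
total degree ≤ p: `|q|²_{1,K} ≤ C (Σ_{ξ ∈ N} q(ξ)² + Σ_{|α| ≤ p−2} (∫_K m_α q)²)`. -/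
theorem stmt_8 (p : ℕ) (hp : 1 ≤ p) :
    ∃ C : ℝ, 0 < C ∧ ∀ q : MvPolynomial (Fin 2) ℝ, q.totalDegree ≤ p →
      (∫ z in Set.Ioo (0 : ℝ) 1 ×ˢ Set.Ioo (0 : ℝ) 1, gradSqP q z) ≤
        C * ((∑ ξ ∈ bdryNodes p, (evP q ξ) ^ 2) +
          ∑ ab ∈ momIdx p,
            (∫ z in Set.Ioo (0 : ℝ) 1 ×ˢ Set.Ioo (0 : ℝ) 1, monC ab z * evP q z) ^ 2) := by
  have hker : LinearMap.ker (dofMap p) = ⊥ := by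
    rw [LinearMap.ker_eq_bot']
    rintro ⟨q, hq⟩ h
    rw [MvPolynomial.mem_restrictTotalDegree] at hq
    apply Subtype.ext
    refine unisolvent p hp q hq (fun ξ hξ => ?_) (fun ab hab => ?_)
    · exact congrFun h (Sum.inl ⟨ξ, hξ⟩)
    · exact congrFun h (Sum.inr ⟨ab, hab⟩)
  obtain ⟨e, he⟩ := exists_repr (dofMap p) hker
  set A : ℝ := ∫ z in Set.Ioo (0 : ℝ) 1 ×ˢ Set.Ioo (0 : ℝ) 1, ∑ i, gradSqP (e i).1 z with hA
  have hA0 : 0 ≤ A := integral_nonneg fun z => Finset.sum_nonneg fun i _ => by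
    simp only [gradSqP]; positivity
  refine ⟨A + 1, by linarith, fun q hq => ?_⟩
  set S : ℝ := (∑ ξ ∈ bdryNodes p, (evP q ξ) ^ 2) + ∑ ab ∈ momIdx p,
    (∫ z in Set.Ioo (0 : ℝ) 1 ×ˢ Set.Ioo (0 : ℝ) 1, monC ab z * evP q z) ^ 2 with hS
  have hS0 : 0 ≤ S := by positivity
  set v : MvPolynomial.restrictTotalDegree (Fin 2) ℝ p :=
    ⟨q, (MvPolynomial.mem_restrictTotalDegree _ _ _).2 hq⟩ with hv
  have hSv : ∑ i, (dofMap p v i) ^ 2 = S := by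
    rw [Fintype.sum_sum_type, hS]
    congr 1
    · exact Finset.sum_coe_sort (bdryNodes p) (fun ξ => (evP q ξ) ^ 2)
    · exact Finset.sum_coe_sort (momIdx p) (fun ab =>
        (∫ z in Set.Ioo (0 : ℝ) 1 ×ˢ Set.Ioo (0 : ℝ) 1, monC ab z * evP q z) ^ 2)
  have hqe : q = ∑ i, dofMap p v i • (e i).1 := by
    have := congrArg Subtype.val (he v)
    simpa using this
  have hb : (∫ z in Set.Ioo (0 : ℝ) 1 ×ˢ Set.Ioo (0 : ℝ) 1, gradSqP q z) ≤ S * A := by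
    rw [hA, ← integral_const_mul]
    refine integral_mono (integrableOn_sq (gradSqP_continuous q))
      (integrableOn_sq (continuous_const.mul
        (continuous_finsetSum _ fun i _ => gradSqP_continuous _))) fun z => ?_
    have := gradSqP_sum_le (fun i => dofMap p v i) (fun i => (e i).1) z
    rw [← hqe, hSv] at this
    exact this
  nlinarith
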